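/- arXiv:1611.08244 — 3 statements merged into one kernel-verified Lean document; each statement's English description precedes it below -/
import Mathlib

section
/- For every integer n ≥ 2, B(n) − B(n−1) ∈ {0, 1}; that is, the B-sequence is slow. -/
/-- The auxiliary sequence: `a 1 = 3`, `a i = 3 * a (i-1) - 1` for `i ≥ 2`. -/
def a : ℕ → ℕ
  | 0 => 0
  | 1 => 3
  | n + 2 => 3 * a (n + 1) - 1

/-- `R(m, i) = max(0, ⌊(m − a i − 1)/3^i⌋)` (truncated ℕ-subtraction gives the max). -/
def Rmi (m i : ℕ) : ℕ := (m - a i - 1) / 3 ^ i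

/-- `R(m) = ∑_{i=1}^∞ R(m, i)`; all terms with `i > m` vanish, so a finite sum suffices. -/
def R (m : ℕ) : ℕ := ∑ i ∈ Finset.Icc 1 m, Rmi m i

/-- `m` has a witness pair `(k, i)` of positive integers with `m = k·3^i + a i`. -/
def HasWitness (m : ℕ) : Prop := ∃ k i : ℕ, 1 ≤ k ∧ 1 ≤ i ∧ m = k * 3 ^ i + a i

/-- `B` is the `B`-sequence: `B 0 = 0`, `B n = n` for `1 ≤ n ≤ 5`, and
`B n = B (n - B (n-1)) + B (n - B (n-2)) + B (n - B (n-3))` for `n ≥ 6`. -/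
def IsBSeq (B : ℕ → ℕ) : Prop :=
  B 0 = 0 ∧ (∀ n, 1 ≤ n → n ≤ 5 → B n = n) ∧
    ∀ n, 6 ≤ n → B n = B (n - B (n - 1)) + B (n - B (n - 2)) + B (n - B (n - 3))

/-- `repeats m` is the number of extra occurrences of the value `m` in the `B`-sequence. -/
def repeats (m : ℕ) : ℕ :=
  if m % 3 = 0 then (if 6 ≤ m then 1 else 0)
  else if m % 3 = 1 then 0
  else if m = 0 then 0 else repeats ((m + 1) / 3)
termination_by m
decreasing_by omega

/-- `firstPos m` is the first position at which the value `m` occurs in the `B`-sequence. -/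
def firstPos : ℕ → ℕ
  | 0 => 0
  | m + 1 => firstPos m + 1 + repeats m

theorem firstPos_succ (m : ℕ) : firstPos (m + 1) = firstPos m + 1 + repeats m := rfl

theorem repeats_three_mul {q : ℕ} (hq : 2 ≤ q) : repeats (3 * q) = 1 := by
  rw [repeats, if_pos (by omega), if_pos (by omega)]

theorem repeats_three_mul_add_one (q : ℕ) : repeats (3 * q + 1) = 0 := by
  rw [repeats, if_neg (by omega), if_pos (by omega)]

theorem repeats_three_mul_add_two (q : ℕ) : repeats (3 * q + 2) = repeats (q + 1) := by
  rw [repeats, if_neg (by omega), if_neg (by omega), if_neg (by omega)]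
  congr 1
  omega

theorem repeats_of_le_five {m : ℕ} (hm : m ≤ 5) : repeats m = 0 := by
  have h0 : repeats 0 = 0 := by rw [repeats]; simp
  have h1 : repeats 1 = 0 := repeats_three_mul_add_one 0
  have h2 : repeats 2 = 0 := (repeats_three_mul_add_two 0).trans h1
  have h3 : repeats 3 = 0 := by rw [repeats]; simp
  have h4 : repeats 4 = 0 := repeats_three_mul_add_one 1
  have h5 : repeats 5 = 0 := (repeats_three_mul_add_two 1).trans h2
  interval_cases m <;> assumption

theorem repeats_le_one (m : ℕ) : repeats m ≤ 1 := by
  induction m using Nat.strong_induction_on with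
  | _ m ih =>
    rw [repeats]
    split_ifs
    all_goals first | omega | exact ih _ (by omega)

theorem firstPos_of_le_six {m : ℕ} (hm : m ≤ 6) : firstPos m = m := by
  induction m with
  | zero => rfl
  | succ m ih => rw [firstPos_succ, ih (by omega), repeats_of_le_five (by omega)]

theorem le_firstPos (m : ℕ) : m ≤ firstPos m := by
  induction m with
  | zero => exact Nat.zero_le _
  | succ m ih => rw [firstPos_succ]; omega

theorem firstPos_three_mul {q : ℕ} (hq : 2 ≤ q) :
    firstPos (3 * q) + 3 = 3 * q + firstPos (q + 1) := by
  induction q, hq using Nat.le_induction with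
  | base =>
    rw [firstPos_of_le_six (by norm_num), firstPos_of_le_six (by norm_num)]
  | succ q hq ih =>
    have h : firstPos (3 * (q + 1)) = firstPos (3 * q + 2) + 1 + repeats (3 * q + 2) := rfl
    have h1 : firstPos (3 * q + 2) = firstPos (3 * q + 1) + 1 + repeats (3 * q + 1) := rfl
    have h2 := firstPos_succ (3 * q)
    have h3 := firstPos_succ (q + 1)
    rw [repeats_three_mul_add_two] at h
    rw [repeats_three_mul_add_one] at h1
    rw [repeats_three_mul hq] at h2
    omega

theorem exists_firstPos_eq_or {n : ℕ} (hn : 1 ≤ n) :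
    ∃ m, 1 ≤ m ∧ (n = firstPos m ∨ repeats m = 1 ∧ n = firstPos m + 1) := by
  induction n, hn using Nat.le_induction with
  | base => exact ⟨1, le_rfl, .inl (firstPos_of_le_six (by norm_num)).symm⟩
  | succ n hn ih =>
    obtain ⟨m, hm, h⟩ := ih
    have hs := firstPos_succ m
    have hw := repeats_le_one m
    by_cases h' : repeats m = 1 ∧ n = firstPos m
    · exact ⟨m, hm, .inr ⟨h'.1, by omega⟩⟩
    · exact ⟨m + 1, by omega, .inl (by omega)⟩

/-- The value `m` occupies exactly the positions predicted by `firstPos` and `repeats`. -/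
def OccursAsPredicted (B : ℕ → ℕ) (m : ℕ) : Prop :=
  B (firstPos m) = m ∧ (repeats m = 1 → B (firstPos m + 1) = m)

theorem OccursAsPredicted.last {B : ℕ → ℕ} {m k : ℕ} (h : OccursAsPredicted B m)
    (hk : k + 1 = firstPos (m + 1)) : B k = m := by
  have hs := firstPos_succ m
  rcases Nat.le_one_iff_eq_zero_or_eq_one.mp (repeats_le_one m) with hw | hw
  · rw [show k = firstPos m by omega, h.1]
  · rw [show k = firstPos m + 1 by omega, h.2 hw]

theorem IsBSeq.eq_of_prev {B : ℕ → ℕ} (hB : IsBSeq B) {n x y z u v w : ℕ} (hn : 6 ≤ n)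
    (hx : B (n - 1) = x) (hy : B (n - 2) = y) (hz : B (n - 3) = z)
    (hu : B (n - x) = u) (hv : B (n - y) = v) (hw : B (n - z) = w) :
    B n = u + v + w := by
  rw [hB.2.2 n hn, hx, hy, hz, hu, hv, hw]

theorem IsBSeq.occursAsPredicted {B : ℕ → ℕ} (hB : IsBSeq B) (m : ℕ) :
    OccursAsPredicted B m := by
  induction m using Nat.strong_induction_on with
  | _ m ih =>
    rcases lt_or_ge m 6 with hm | hm
    · refine ⟨?_, fun h => ?_⟩
      · rw [firstPos_of_le_six hm.le]
        rcases Nat.eq_zero_or_pos m with rfl | h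
        · exact hB.1
        · exact hB.2.1 m h (by omega)
      · rw [repeats_of_le_five (by omega)] at h
        omega
    obtain ⟨q, hq, hmq⟩ : ∃ q, 2 ≤ q ∧ (m = 3 * q ∨ m = 3 * q + 1 ∨ m = 3 * q + 2) :=
      ⟨m / 3, by omega, by omega⟩
    have hP := firstPos_three_mul hq
    have hle := le_firstPos (q + 1)
    have w0 := repeats_three_mul hq
    have w1 := repeats_three_mul_add_one q
    have w2 := repeats_three_mul_add_two q
    have P1 := firstPos_succ (3 * q)
    have P2 : firstPos (3 * q + 2) = firstPos (3 * q + 1) + 1 + repeats (3 * q + 1) := rfl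
    have Pq := firstPos_succ q
    have Bq : ∀ k, k + 1 = firstPos (q + 1) → B k = q := fun k => (ih q (by omega)).last
    have Bq1 : ∀ k, k = firstPos (q + 1) → B k = q + 1 := by
      rintro k rfl
      exact (ih (q + 1) (by omega)).1
    rcases hmq with rfl | rfl | rfl
    · obtain ⟨r, rfl⟩ : ∃ r, q = r + 1 := ⟨q - 1, by omega⟩
      have v1 := repeats_three_mul_add_one r
      have v2 := repeats_three_mul_add_two r
      have Q1 : firstPos (3 * (r + 1)) = firstPos (3 * r + 2) + 1 + repeats (3 * r + 2) := rfl
      have Q2 : firstPos (3 * r + 2) = firstPos (3 * r + 1) + 1 + repeats (3 * r + 1) := rfl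
      have C1 : ∀ k, k + 1 = firstPos (3 * (r + 1)) → B k = 3 * r + 2 :=
        fun k => (ih (3 * r + 2) (by omega)).last
      have C2 : ∀ k, k + 1 = firstPos (3 * r + 2) → B k = 3 * r + 1 :=
        fun k => (ih (3 * r + 1) (by omega)).last
      have C3 : ∀ k, k + 1 = firstPos (3 * r + 1) → B k = 3 * r :=
        fun k => (ih (3 * r) (by omega)).last
      rcases Nat.le_one_iff_eq_zero_or_eq_one.mp (repeats_le_one (r + 1)) with hw | hw
      · have Br : ∀ k, k + 2 = firstPos (r + 1 + 1) → B k = r :=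
          fun k hk => (ih r (by omega)).last (by omega)
        have h1 : B (firstPos (3 * (r + 1))) = 3 * (r + 1) := by
          rw [hB.eq_of_prev (by omega) (C1 _ (by omega)) (C2 _ (by omega)) (C3 _ (by omega))
            (Br _ (by omega)) (Bq _ (by omega)) (Bq1 _ (by omega))]
          omega
        refine ⟨h1, fun _ => ?_⟩
        rw [hB.eq_of_prev (by omega) h1 (C1 _ (by omega)) (C2 _ (by omega))
          (Br _ (by omega)) (Bq _ (by omega)) (Bq1 _ (by omega))]
        omega
      · have Bq' : ∀ k, k + 2 = firstPos (r + 1 + 1) → B k = r + 1 := by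
          intro k hk
          rw [show k = firstPos (r + 1) by omega]
          exact (ih (r + 1) (by omega)).1
        have C1' : ∀ k, k + 2 = firstPos (3 * (r + 1)) → B k = 3 * r + 2 := by
          intro k hk
          rw [show k = firstPos (3 * r + 2) by omega]
          exact (ih (3 * r + 2) (by omega)).1
        have h1 : B (firstPos (3 * (r + 1))) = 3 * (r + 1) := by
          rw [hB.eq_of_prev (by omega) (C1 _ (by omega)) (C1' _ (by omega)) (C2 _ (by omega))
            (Bq' _ (by omega)) (Bq' _ (by omega)) (Bq _ (by omega))]
          omega
        refine ⟨h1, fun _ => ?_⟩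
        rw [hB.eq_of_prev (by omega) h1 (C1 _ (by omega)) (C1' _ (by omega))
          (Bq' _ (by omega)) (Bq _ (by omega)) (Bq _ (by omega))]
        omega
    · have C0 := ih (3 * q) (by omega)
      have C0' : ∀ k, k = firstPos (3 * q) → B k = 3 * q := by
        rintro k rfl
        exact C0.1
      have C1 : ∀ k, k + 1 = firstPos (3 * q) → B k = 3 * q - 1 := fun k hk =>
        (ih (3 * q - 1) (by omega)).last (by rw [hk]; congr 1; omega)
      refine ⟨?_, fun h => by omega⟩
      rw [hB.eq_of_prev (by omega) (C0.last (by omega))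
        (C0' _ (by omega)) (C1 _ (by omega))
        (Bq _ (by omega)) (Bq _ (by omega)) (Bq1 _ (by omega))]
      omega
    · have C0 := ih (3 * q) (by omega)
      have C0' : ∀ k, k = firstPos (3 * q) → B k = 3 * q := by
        rintro k rfl
        exact C0.1
      have C1 : ∀ k, k = firstPos (3 * q + 1) → B k = 3 * q + 1 := by
        rintro k rfl
        exact (ih (3 * q + 1) (by omega)).1
      have h1 : B (firstPos (3 * q + 2)) = 3 * q + 2 := by
        rw [hB.eq_of_prev (by omega) (C1 _ (by omega)) (C0.last (by omega)) (C0' _ (by omega))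
          (Bq _ (by omega)) (Bq1 _ (by omega)) (Bq1 _ (by omega))]
        omega
      refine ⟨h1, fun h => ?_⟩
      have Bq1' : ∀ k, k = firstPos (q + 1) + 1 → B k = q + 1 := by
        rintro k rfl
        exact (ih (q + 1) (by omega)).2 (by omega)
      rw [hB.eq_of_prev (by omega) h1 (C1 _ (by omega)) (C0.last (by omega))
        (Bq _ (by omega)) (Bq1 _ (by omega)) (Bq1' _ (by omega))]
      omega

/-- For every integer n ≥ 2, B(n) − B(n−1) ∈ {0, 1}; i.e., the B-sequence is slow. -/
theorem stmt_0 (B : ℕ → ℕ) (hB : IsBSeq B) :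
    ∀ n : ℕ, 2 ≤ n → (B n : ℤ) - B (n - 1) ∈ ({0, 1} : Set ℤ) := by
  intro n hn
  obtain ⟨m, hm, rfl | ⟨hw, rfl⟩⟩ := exists_firstPos_eq_or (show 1 ≤ n by omega)
  · obtain ⟨r, rfl⟩ : ∃ r, m = r + 1 := ⟨m - 1, by omega⟩
    rw [(hB.occursAsPredicted (r + 1)).1,
      (hB.occursAsPredicted r).last (Nat.sub_add_cancel (by omega))]
    simp
  · rw [(hB.occursAsPredicted m).2 hw, Nat.add_sub_cancel, (hB.occursAsPredicted m).1]
    simp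
end

section
/- For every integer m ≥ 2, B(m + R(m) − 1) = m − 1 and B(m + R(m)) = m; in particular, m + R(m) − 1 is the largest index n ≥ 1 with B(n) ≤ m − 1. -/
theorem succ_lt_a_succ (i : ℕ) : i + 2 < a (i + 1) := by
  induction i with
  | zero => simp [a]
  | succ k ih => simp only [a]; omega

theorem Rmi_one (m : ℕ) : Rmi m 1 = (m - 4) / 3 := by
  simp only [Rmi, a, pow_one]
  omega

theorem Rmi_add_two (m i : ℕ) : Rmi m (i + 2) = Rmi (m / 3 + 1) (i + 1) := by
  have h := succ_lt_a_succ i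
  have e : a (i + 2) = 3 * a (i + 1) - 1 := rfl
  unfold Rmi
  rw [e, pow_succ' 3 (i + 1), ← Nat.div_div_eq_div_mul]
  congr 1
  omega

theorem R_eq_sum_range {m N : ℕ} (h : m ≤ N) : R m = ∑ i ∈ Finset.range N, Rmi m (i + 1) := by
  have hR : R m = ∑ i ∈ Finset.range m, Rmi m (i + 1) := by
    rw [R, Finset.range_eq_Ico, Finset.sum_Ico_add' (fun i => Rmi m i) 0 m 1]
    rfl
  rw [hR]
  refine Finset.sum_subset (Finset.range_mono h) fun i _ hi => ?_
  have hi' : m ≤ i := by simpa using hi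
  have ha := succ_lt_a_succ i
  have h0 : m - a (i + 1) - 1 = 0 := by omega
  rw [Rmi, h0, Nat.zero_div]

theorem R_eq_add_R_div (m : ℕ) : R m = (m - 4) / 3 + R (m / 3 + 1) := by
  rw [R_eq_sum_range (show m ≤ m + 1 + 1 by omega), Finset.sum_range_succ',
    R_eq_sum_range (show m / 3 + 1 ≤ m + 1 by omega), zero_add, Rmi_one, add_comm]
  simp only [add_assoc, Nat.reduceAdd, Rmi_add_two]

theorem R_three_mul (q : ℕ) : R (3 * q + 3) = q + R (q + 2) - (if q = 0 then 0 else 1) := by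
  rw [R_eq_add_R_div, show (3 * q + 3) / 3 + 1 = q + 2 by omega]
  split <;> omega

theorem R_three_mul_add_one (q : ℕ) : R (3 * q + 4) = q + R (q + 2) := by
  rw [R_eq_add_R_div, show (3 * q + 4) / 3 + 1 = q + 2 by omega]
  omega

theorem R_three_mul_add_two (q : ℕ) : R (3 * q + 5) = q + R (q + 2) := by
  rw [R_eq_add_R_div, show (3 * q + 5) / 3 + 1 = q + 2 by omega]
  omega

theorem R_eq_zero {m : ℕ} (h : m ≤ 6) : R m = 0 := by
  interval_cases m <;> decide

theorem R_succ_bounds (m : ℕ) : R m ≤ R (m + 1) ∧ R (m + 1) ≤ R m + 1 := by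
  induction m using Nat.strong_induction_on with
  | _ m ih =>
    by_cases h : m < 6
    · simp [R_eq_zero (show m ≤ 6 by omega), R_eq_zero (show m + 1 ≤ 6 by omega)]
    obtain ⟨q, hq⟩ : ∃ q, m = 3 * q + 6 ∨ m = 3 * q + 7 ∨ m = 3 * q + 8 := ⟨(m - 6) / 3, by omega⟩
    have h₀ := R_three_mul (q + 1)
    have h₁ := R_three_mul_add_one (q + 1)
    have h₂ := R_three_mul_add_two (q + 1)
    have h₃ := R_three_mul (q + 2)
    simp only [mul_add, add_assoc, Nat.reduceAdd, Nat.reduceMul, Nat.add_eq_zero_iff,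
      OfNat.ofNat_ne_zero, one_ne_zero, and_false, if_false] at h₀ h₁ h₂ h₃
    have h₄ := ih (q + 3) (by omega)
    rcases hq with rfl | rfl | rfl <;> simp only [add_assoc, Nat.reduceAdd] at h₄ ⊢ <;> omega

/-- The value `m` occupies exactly the indices from `m + R m` up to `m + R (m + 1)`. -/
theorem IsBSeq.eq_of_mem_block {B : ℕ → ℕ} (hB : IsBSeq B) (m : ℕ) :
    ∀ n, m + R m ≤ n → n ≤ m + R (m + 1) → B n = m := by
  obtain ⟨hB0, hB5, hrec⟩ := hB
  induction m using Nat.strong_induction_on with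
  | _ m ih =>
    by_cases h : m < 6
    · intro n hn₁ hn₂
      rw [R_eq_zero (show m ≤ 6 by omega)] at hn₁
      rw [R_eq_zero (show m + 1 ≤ 6 by omega)] at hn₂
      obtain rfl : n = m := by omega
      rcases Nat.eq_zero_or_pos n with rfl | hpos
      · exact hB0
      · exact hB5 n hpos (by omega)
    have step (n x y z u v w : ℕ) (hn : m ≤ n) (hx : B (n - 1) = x) (hy : B (n - 2) = y)
        (hz : B (n - 3) = z) (hu : B (n - x) = u) (hv : B (n - y) = v) (hw : B (n - z) = w)
        (hs : u + v + w = m) : B n = m := by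
      rw [hrec n (by omega), hx, hy, hz, hu, hv, hw, hs]
    obtain ⟨q, hq⟩ : ∃ q, m = 3 * q + 6 ∨ m = 3 * q + 7 ∨ m = 3 * q + 8 := ⟨(m - 6) / 3, by omega⟩
    have h₀ := R_three_mul (q + 1)
    have h₁ := R_three_mul_add_one (q + 1)
    have h₂ := R_three_mul_add_two (q + 1)
    have h₃ := R_three_mul (q + 2)
    have h₄ := R_three_mul_add_one q
    have h₅ := R_three_mul_add_two q
    simp only [mul_add, add_assoc, Nat.reduceAdd, Nat.reduceMul, Nat.add_eq_zero_iff,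
      OfNat.ofNat_ne_zero, one_ne_zero, and_false, if_false] at h₀ h₁ h₂ h₃ h₄ h₅
    have s₁ := R_succ_bounds (q + 1)
    have s₂ := R_succ_bounds (q + 2)
    have s₃ := R_succ_bounds (q + 3)
    have s₄ := R_succ_bounds (3 * q + 3)
    have b₁ := ih (q + 1) (by omega)
    have b₂ := ih (q + 2) (by omega)
    have b₃ := ih (q + 3) (by omega)
    have c₁ := ih (m - 1) (by omega)
    have c₂ := ih (m - 2) (by omega)
    have c₃ := ih (m - 3) (by omega)
    simp only [add_assoc, Nat.reduceAdd] at s₁ s₂ s₃ s₄ b₁ b₂ b₃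
    have hfirst : B (m + R m) = m := by
      rcases hq with rfl | rfl | rfl <;>
        simp only [add_assoc, Nat.reduceAdd, Nat.add_one_sub_one, Nat.reduceSubDiff] at c₁ c₂ c₃ ⊢
      · rcases Nat.eq_or_lt_of_le s₂.1 with hs | hs
        · exact step _ (3 * q + 5) (3 * q + 4) (3 * q + 3) (q + 1) (q + 2) (q + 3) (by omega)
            (c₁ _ (by omega) (by omega)) (c₂ _ (by omega) (by omega)) (c₃ _ (by omega) (by omega))
            (b₁ _ (by omega) (by omega)) (b₂ _ (by omega) (by omega)) (b₃ _ (by omega) (by omega))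
            (by omega)
        · exact step _ (3 * q + 5) (3 * q + 5) (3 * q + 4) (q + 2) (q + 2) (q + 2) (by omega)
            (c₁ _ (by omega) (by omega)) (c₁ _ (by omega) (by omega)) (c₂ _ (by omega) (by omega))
            (b₂ _ (by omega) (by omega)) (b₂ _ (by omega) (by omega)) (b₂ _ (by omega) (by omega))
            (by omega)
      · exact step _ (3 * q + 6) (3 * q + 6) (3 * q + 5) (q + 2) (q + 2) (q + 3) (by omega)
          (c₁ _ (by omega) (by omega)) (c₁ _ (by omega) (by omega)) (c₂ _ (by omega) (by omega))
          (b₂ _ (by omega) (by omega)) (b₂ _ (by omega) (by omega)) (b₃ _ (by omega) (by omega))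
          (by omega)
      · exact step _ (3 * q + 7) (3 * q + 6) (3 * q + 6) (q + 2) (q + 3) (q + 3) (by omega)
          (c₁ _ (by omega) (by omega)) (c₂ _ (by omega) (by omega)) (c₂ _ (by omega) (by omega))
          (b₂ _ (by omega) (by omega)) (b₃ _ (by omega) (by omega)) (b₃ _ (by omega) (by omega))
          (by omega)
    intro n hn₁ hn₂
    rcases Nat.eq_or_lt_of_le hn₁ with rfl | hn
    · exact hfirst
    have hprev : B (n - 1) = m := by
      have hsucc := R_succ_bounds m
      rwa [show n - 1 = m + R m by omega]
    rcases hq with rfl | rfl | rfl <;>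
      simp only [add_assoc, Nat.reduceAdd, Nat.add_one_sub_one, Nat.reduceSubDiff] at hn₂ c₁ c₂ c₃
    · rcases Nat.eq_or_lt_of_le s₂.1 with hs | hs
      · exact step _ (3 * q + 6) (3 * q + 5) (3 * q + 4) (q + 1) (q + 2) (q + 3) (by omega)
          hprev (c₁ _ (by omega) (by omega)) (c₂ _ (by omega) (by omega))
          (b₁ _ (by omega) (by omega)) (b₂ _ (by omega) (by omega)) (b₃ _ (by omega) (by omega))
          (by omega)
      · exact step _ (3 * q + 6) (3 * q + 5) (3 * q + 5) (q + 2) (q + 2) (q + 2) (by omega)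
          hprev (c₁ _ (by omega) (by omega)) (c₁ _ (by omega) (by omega))
          (b₂ _ (by omega) (by omega)) (b₂ _ (by omega) (by omega)) (b₂ _ (by omega) (by omega))
          (by omega)
    · omega
    · exact step _ (3 * q + 8) (3 * q + 7) (3 * q + 6) (q + 2) (q + 3) (q + 3) (by omega)
        hprev (c₁ _ (by omega) (by omega)) (c₂ _ (by omega) (by omega))
        (b₂ _ (by omega) (by omega)) (b₃ _ (by omega) (by omega)) (b₃ _ (by omega) (by omega))
        (by omega)

/-- for `m ≥ 2`, `B (m + R m - 1) = m - 1` and `B (m + R m) = m`; in particular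
`m + R m - 1` is the largest index `n ≥ 1` with `B n ≤ m - 1`. -/
theorem stmt_3 (B : ℕ → ℕ) (hB : IsBSeq B) (m : ℕ) (hm : 2 ≤ m) :
    B (m + R m - 1) = m - 1 ∧ B (m + R m) = m ∧
    IsGreatest {n : ℕ | 1 ≤ n ∧ B n ≤ m - 1} (m + R m - 1) := by
  have block := hB.eq_of_mem_block
  have hlast : B (m + R m - 1) = m - 1 := by
    obtain ⟨k, rfl⟩ : ∃ k, m = k + 1 := ⟨m - 1, by omega⟩
    have := R_succ_bounds k
    exact block k _ (by omega) (by omega)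
  have hfirst : B (m + R m) = m := by
    have := R_succ_bounds m
    exact block m _ le_rfl (by omega)
  refine ⟨hlast, hfirst, ⟨by omega, hlast.le⟩, fun n hn => ?_⟩
  by_contra hlt
  have hle : m + R m ≤ n := by omega
  have hcover : ∃ k, m ≤ k ∧ k + R k ≤ n ∧ n ≤ k + R (k + 1) := by
    clear hn hlt
    induction n, hle using Nat.le_induction with
    | base => exact ⟨m, le_rfl, le_rfl, by have := R_succ_bounds m; omega⟩
    | succ n hmn ih =>
      obtain ⟨k, hk, h₁, h₂⟩ := ih
      by_cases h : n + 1 ≤ k + R (k + 1)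
      · exact ⟨k, hk, by omega, h⟩
      · have := R_succ_bounds (k + 1)
        exact ⟨k + 1, by omega, by omega, by omega⟩
  obtain ⟨k, hk, h₁, h₂⟩ := hcover
  have := block k n h₁ h₂
  have := hn.2
  omega
end

section
/- Let m be a positive multiple of 3 and let i ≥ 2 be an integer. If i is a witness for m − 1 (i.e., there exists a positive integer k with m − 1 = k·3^i + a_i), then R(m, i) = R(m/3, i−1) + 1; otherwise R(m, i) = R(m/3, i−1). -/
theorem three_le_a_succ (j : ℕ) : 3 ≤ a (j + 1) := by
  induction j with
  | zero => simp [a]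
  | succ j ih => simp only [a]; omega

theorem Rmi_three_mul (n j : ℕ) : Rmi (3 * n) (j + 2) = (n - a (j + 1)) / 3 ^ (j + 1) := by
  have hb := three_le_a_succ j
  have hsub : 3 * n - a (j + 2) - 1 = 3 * (n - a (j + 1)) := by simp only [a]; omega
  rw [Rmi, hsub, pow_succ' 3 (j + 1), Nat.mul_div_mul_left _ _ (by norm_num)]

theorem witness_three_mul_sub_one_iff {n : ℕ} (hn : 1 ≤ n) (j k : ℕ) :
    3 * n - 1 = k * 3 ^ (j + 2) + a (j + 2) ↔ n = k * 3 ^ (j + 1) + a (j + 1) := by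
  have hb := three_le_a_succ j
  rw [show k * 3 ^ (j + 2) = 3 * (k * 3 ^ (j + 1)) by ring]
  simp only [a]
  omega

/-- for `m` a positive multiple of 3 and `i ≥ 2`: if `i` is a witness for `m - 1`
then `R(m, i) = R(m/3, i-1) + 1`, and otherwise `R(m, i) = R(m/3, i-1)`. -/
theorem stmt_4 (m i : ℕ) (hm : 1 ≤ m) (h3 : 3 ∣ m) (hi : 2 ≤ i) :
    ((∃ k : ℕ, 1 ≤ k ∧ m - 1 = k * 3 ^ i + a i) → Rmi m i = Rmi (m / 3) (i - 1) + 1) ∧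
    (¬(∃ k : ℕ, 1 ≤ k ∧ m - 1 = k * 3 ^ i + a i) → Rmi m i = Rmi (m / 3) (i - 1)) := by
  obtain ⟨n, rfl⟩ := h3
  obtain ⟨j, rfl⟩ := Nat.exists_eq_add_of_le' hi
  simp only [witness_three_mul_sub_one_iff (show 1 ≤ n by omega), Rmi_three_mul,
    Nat.mul_div_cancel_left n (show 0 < 3 by norm_num), show j + 2 - 1 = j + 1 from rfl]
  unfold Rmi
  have hq : 0 < 3 ^ (j + 1) := by positivity
  generalize 3 ^ (j + 1) = q at hq ⊢
  generalize a (j + 1) = b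
  constructor
  · rintro ⟨k, hk, rfl⟩
    have hpos : 1 ≤ k * q := Nat.mul_pos hk hq
    obtain ⟨d, hd⟩ := Nat.exists_eq_add_of_le' hpos
    rw [Nat.add_sub_cancel, hd, Nat.add_sub_cancel, Nat.succ_div_of_dvd (hd ▸ dvd_mul_left q k)]
  · intro hk
    rcases h : n - b with _ | d
    · rfl
    · rw [Nat.add_sub_cancel, Nat.succ_div_of_not_dvd]
      rintro ⟨k, hkd⟩
      refine hk ⟨k, Nat.pos_of_ne_zero ?_, ?_⟩
      · rintro rfl
        omega
      · rw [mul_comm k q]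
        omega
end
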